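/- (Iterated factorization of the (ρ,q)-factorial along powers of p.) Let p be a prime, R a commutative ring, ρ, q ∈ R, and let n ≥ 1 with p^m ≤ n < p^{m+1}. Then [n]!_{ρ,q} = (∏_{i=0}^{m} ∏_{1≤j≤⌊n/p^i⌋, p∤j} [j]_{ρ^{p^i}, q^{p^i}}) · ∏_{i=0}^{m−1} ([p]_{ρ^{p^i}, q^{p^i}})^{⌊n/p^{i+1}⌋}, where ⌊·⌋ is the floor function. (Consequently the total exponent Σ_{i=1}^{m} ⌊n/p^i⌋ of the p-number factors equals (n − s_p(n))/(p − 1), with s_p(n) the sum of the base-p digits of n.) -/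

import Mathlib

/-- The `(ρ,q)`-number over a commutative ring:
`[n]_{ρ,q} = Σ_{i=0}^{n−1} ρ^{n−1−i} qⁱ`. -/
def pqNum {R : Type*} [CommRing R] (ρ q : R) (n : ℕ) : R :=
  ∑ i ∈ Finset.range n, ρ ^ (n - 1 - i) * q ^ i

/-- The `(ρ,q)`-factorial `[n]!_{ρ,q} = ∏_{j=1}^{n} [j]_{ρ,q}`. -/
def pqFactorial {R : Type*} [CommRing R] (ρ q : R) (n : ℕ) : R :=
  ∏ j ∈ Finset.range n, pqNum ρ q (j + 1)

theorem pqNum_zero {R : Type*} [CommRing R] (ρ q : R) : pqNum ρ q 0 = 0 := by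
  simp [pqNum]

theorem pqNum_succ {R : Type*} [CommRing R] (ρ q : R) (n : ℕ) :
    pqNum ρ q (n + 1) = ρ * pqNum ρ q n + q ^ n := by
  simp only [pqNum, Finset.sum_range_succ, Finset.mul_sum]
  congr 1
  · refine Finset.sum_congr rfl fun i hi => ?_
    have hi := Finset.mem_range.mp hi
    rw [show n + 1 - 1 - i = (n - 1 - i) + 1 by omega, pow_succ']
    ring
  · simp

theorem pqNum_add {R : Type*} [CommRing R] (ρ q : R) (a b : ℕ) :
    pqNum ρ q (a + b) = ρ ^ b * pqNum ρ q a + q ^ a * pqNum ρ q b := by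
  induction b with
  | zero => simp [pqNum_zero]
  | succ b ih =>
    rw [← add_assoc, pqNum_succ, ih, pqNum_succ]
    ring

theorem pqNum_mul {R : Type*} [CommRing R] (ρ q : R) (a b : ℕ) :
    pqNum ρ q (a * b) = pqNum ρ q a * pqNum (ρ ^ a) (q ^ a) b := by
  induction b with
  | zero => simp [pqNum_zero]
  | succ b ih =>
    rw [mul_add_one, pqNum_add, ih, pqNum_succ, ← pow_mul]
    ring

theorem pqFactorial_succ {R : Type*} [CommRing R] (ρ q : R) (n : ℕ) :
    pqFactorial ρ q (n + 1) = pqFactorial ρ q n * pqNum ρ q (n + 1) :=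
  Finset.prod_range_succ _ _

/-- Separating the factors of the `(ρ,q)`-factorial whose index is a multiple of `p`. -/
theorem pqFactorial_eq_prod_filter_mul {R : Type*} [CommRing R] (ρ q : R) (p n : ℕ) :
    pqFactorial ρ q n =
      (∏ j ∈ (Finset.range (n + 1)).filter (fun j => ¬ p ∣ j), pqNum ρ q j) *
        pqNum ρ q p ^ (n / p) * pqFactorial (ρ ^ p) (q ^ p) (n / p) := by
  induction n with
  | zero => simp [pqFactorial, Finset.filter_singleton]
  | succ n ih =>
    rw [pqFactorial_succ, ih, Finset.range_add_one (n := n + 1), Finset.filter_insert,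
      Nat.succ_div]
    by_cases h : p ∣ n + 1
    · have key : n + 1 = p * (n / p + 1) := by
        have := Nat.mul_div_cancel' h
        rwa [Nat.succ_div, if_pos h, eq_comm] at this
      rw [if_neg (not_not.mpr h), if_pos h, pqFactorial_succ, pow_succ]
      have hmul := pqNum_mul ρ q p (n / p + 1)
      rw [← key] at hmul
      rw [hmul]
      ring
    · rw [if_pos h, if_neg h, Finset.prod_insert (by simp), add_zero]
      ring

theorem pqFactorial_eq_prod_mul_prod_pow {R : Type*} [CommRing R] (ρ q : R) {p n m : ℕ}
    (hn : n < p ^ (m + 1)) :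
    pqFactorial ρ q n =
      (∏ i ∈ Finset.range (m + 1),
          ∏ j ∈ (Finset.range (n / p ^ i + 1)).filter (fun j => ¬ p ∣ j),
            pqNum (ρ ^ p ^ i) (q ^ p ^ i) j) *
        ∏ i ∈ Finset.range m, pqNum (ρ ^ p ^ i) (q ^ p ^ i) p ^ (n / p ^ (i + 1)) := by
  induction m generalizing ρ q n with
  | zero =>
    rw [pqFactorial_eq_prod_filter_mul ρ q p n, Nat.div_eq_of_lt (by simpa using hn)]
    simp [pqFactorial]
  | succ m ih =>
    have hlt : n / p < p ^ (m + 1) := Nat.div_lt_of_lt_mul (by rwa [← pow_succ'])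
    rw [Finset.prod_range_succ' _ m, Finset.prod_range_succ' _ (m + 1),
      pqFactorial_eq_prod_filter_mul ρ q p n, ih _ _ hlt]
    simp only [Nat.div_div_eq_div_mul, ← pow_mul, ← pow_succ', pow_zero, pow_one, Nat.div_one,
      zero_add]
    ring

/-- Iterated factorization of the `(ρ,q)`-factorial along powers of `p`:
if `p^m ≤ n < p^{m+1}` then
`[n]!_{ρ,q} = (∏_{i=0}^{m} ∏_{1≤j≤⌊n/p^i⌋, p∤j} [j]_{ρ^{p^i},q^{p^i}})
  · ∏_{i=0}^{m−1} ([p]_{ρ^{p^i},q^{p^i}})^{⌊n/p^{i+1}⌋}`,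
and the total exponent `Σ_{i=1}^{m} ⌊n/p^i⌋` of the `p`-number factors equals
`(n − s_p(n))/(p − 1)` with `s_p(n)` the sum of the base-`p` digits of `n`. -/
theorem pq_factorial_iterated_factorization
    (p : ℕ) (hp : p.Prime) (R : Type*) [CommRing R] (ρ q : R) (n m : ℕ)
    (hn : 1 ≤ n) (hlo : p ^ m ≤ n) (hhi : n < p ^ (m + 1)) :
    pqFactorial ρ q n =
      (∏ i ∈ Finset.range (m + 1),
          ∏ j ∈ (Finset.range (n / p ^ i + 1)).filter (fun j => ¬ p ∣ j),
            pqNum (ρ ^ p ^ i) (q ^ p ^ i) j) *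
        ∏ i ∈ Finset.range m, pqNum (ρ ^ p ^ i) (q ^ p ^ i) p ^ (n / p ^ (i + 1)) ∧
    ∑ i ∈ Finset.range m, n / p ^ (i + 1) = (n - (Nat.digits p n).sum) / (p - 1) := by
  refine ⟨pqFactorial_eq_prod_mul_prod_pow ρ q hhi, ?_⟩
  have hdigits := Nat.sub_one_mul_sum_log_div_pow_eq_sub_sum_digits (p := p) n
  rw [Nat.log_eq_of_pow_le_of_lt_pow hlo hhi, Finset.sum_range_succ,
    Nat.div_eq_of_lt hhi, add_zero] at hdigits
  rw [← hdigits, Nat.mul_div_cancel_left _ (Nat.sub_pos_of_lt hp.one_lt)]
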